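/- arXiv:2605.00484 — 6 statements merged into one kernel-verified Lean document; each statement's English description precedes it below -/
import Mathlib

section
/- Let n ≥ 1 and let k_1, …, k_n be nonzero integers satisfying k_1^{2l+1} + k_2^{2l+1} + ⋯ + k_n^{2l+1} = 0 for every l = 0, 1, …, n−1. Then n is even, say n = 2m, and the tuple is paired: there exists a permutation σ of {1, …, n} such that k_{σ(2j−1)} + k_{σ(2j)} = 0 for every j = 1, …, m. In particular, if n is odd there is no such tuple. -/
open Polynomial in
/-- If enough odd power sums of integers vanish, then each nonzero value is taken as often as its
negative. -/
theorem card_fiber_eq_card_fiber_neg {ι : Type*} [Fintype ι] (k : ι → ℤ)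
    (h : ∀ l < Fintype.card ι, ∑ j, k j ^ (2 * l + 1) = 0) {v : ℤ} (hv : v ≠ 0) :
    Fintype.card {j // k j = v} = Fintype.card {j // -k j = v} := by
  classical
  by_cases hex : ∃ i, k i ^ 2 = v ^ 2
  · obtain ⟨i, hi⟩ := hex
    set S : Finset ℤ := (Finset.univ.image fun j => k j ^ 2).erase (v ^ 2) with hS
    set p : ℤ[X] := ∏ s ∈ S, (X - C s) with hp
    have hmem : v ^ 2 ∈ Finset.univ.image fun j => k j ^ 2 :=
      Finset.mem_image.2 ⟨i, Finset.mem_univ i, hi⟩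
    have hdeg : p.natDegree < Fintype.card ι := by
      rw [hp, natDegree_finsetProd_X_sub_C_eq_card]
      exact (Finset.card_erase_lt_of_mem hmem).trans_le Finset.card_image_le
    have hsum : ∑ j, k j * p.eval (k j ^ 2) = 0 := by
      simp_rw [eval_eq_sum_range, Finset.mul_sum]
      rw [Finset.sum_comm]
      refine Finset.sum_eq_zero fun l hl => ?_
      have hl' := h l (by rw [Finset.mem_range] at hl; omega)
      calc ∑ j, k j * (p.coeff l * (k j ^ 2) ^ l)
          = p.coeff l * ∑ j, k j ^ (2 * l + 1) := by
            rw [Finset.mul_sum]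
            exact Finset.sum_congr rfl fun j _ => by ring
        _ = 0 := by rw [hl', mul_zero]
    have hpv : p.eval (v ^ 2) ≠ 0 := by
      rw [hp, eval_prod, Finset.prod_ne_zero_iff]
      intro s hs
      have := Finset.ne_of_mem_erase hs
      simpa [sub_eq_zero] using this.symm
    have hterm : ∀ j, k j * p.eval (k j ^ 2) =
        v * p.eval (v ^ 2) * ((if k j = v then 1 else 0) - if -k j = v then 1 else 0) := by
      intro j
      by_cases h1 : k j = v
      · have : ¬ -v = v := by omega
        simp [h1, this]
      by_cases h2 : -k j = v
      · have h3 : k j ^ 2 = v ^ 2 := by rw [← h2]; ring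
        simp only [h3, if_neg h1, if_pos h2]
        rw [show k j = -v by omega]
        ring
      · have h3 : k j ^ 2 ≠ v ^ 2 := by
          rw [Ne, sq_eq_sq_iff_eq_or_eq_neg]
          omega
        have : p.eval (k j ^ 2) = 0 := by
          rw [hp, eval_prod]
          refine Finset.prod_eq_zero (i := k j ^ 2) ?_ (by simp)
          exact Finset.mem_erase.2 ⟨h3, Finset.mem_image_of_mem _ (Finset.mem_univ j)⟩
        simp [this, h1, h2]
    simp_rw [hterm, ← Finset.mul_sum, Finset.sum_sub_distrib, Finset.sum_boole] at hsum
    have := (mul_eq_zero.1 hsum).resolve_left (mul_ne_zero hv hpv)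
    rw [Fintype.card_subtype, Fintype.card_subtype]
    exact_mod_cast sub_eq_zero.1 this
  · push Not at hex
    have : IsEmpty {j // k j = v} := ⟨fun j => hex j.1 (by rw [j.2])⟩
    have : IsEmpty {j // -k j = v} := ⟨fun ⟨j, hj⟩ => hex j (by rw [← hj]; ring)⟩
    simp

/-- A finite family of nonzero integers taking each nonzero value as often as its negative can be
indexed by pairs of opposite entries. -/
theorem exists_equiv_prod_fin_two {ι : Type*} [Fintype ι] (k : ι → ℤ) (hk : ∀ j, k j ≠ 0)
    (h : ∀ v ≠ 0, Fintype.card {j // k j = v} = Fintype.card {j // -k j = v}) :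
    ∃ (m : ℕ) (e : Fin m × Fin 2 ≃ ι), ∀ i, k (e (i, 0)) + k (e (i, 1)) = 0 := by
  classical
  have hfib : ∀ v, Nonempty ({j // k j = v} ≃ {j // -k j = v}) := by
    intro v
    rcases eq_or_ne v 0 with rfl | hv
    · have : IsEmpty {j // k j = 0} := ⟨fun j => hk j.1 j.2⟩
      have : IsEmpty {j // -k j = 0} := ⟨fun j => hk j.1 (neg_eq_zero.1 j.2)⟩
      exact ⟨Equiv.equivOfIsEmpty _ _⟩
    · exact ⟨Fintype.equivOfCardEq (h v hv)⟩
  let s : ι ≃ ι := Equiv.ofFiberEquiv (f := k) (g := fun j => -k j) fun v => (hfib v).some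
  have hs : ∀ j, -k (s j) = k j := fun j => Equiv.ofFiberEquiv_map (g := fun j => -k j) _ j
  let P := {j // 0 < k j}
  let a : Fin (Fintype.card P) ≃ P := (Fintype.equivFin P).symm
  let F : Fin (Fintype.card P) × Fin 2 → ι := fun x => if x.2 = 0 then a x.1 else s (a x.1)
  have hF : Function.Bijective F := by
    constructor
    · rintro ⟨i, b⟩ ⟨i', b'⟩ hii
      have hi := (a i).2
      have hi' := (a i').2
      have hsi := hs (a i)
      have hsi' := hs (a i')
      have hkk := congrArg k hii
      fin_cases b <;> fin_cases b' <;> simp [F] at hii hkk ⊢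
      · exact a.injective (Subtype.ext hii)
      · omega
      · omega
      · exact a.injective (Subtype.ext hii)
    · intro j
      by_cases hj : 0 < k j
      · exact ⟨(a.symm ⟨j, hj⟩, 0), by simp [F]⟩
      · have hpos : 0 < k (s.symm j) := by
          have h1 := hs (s.symm j)
          rw [s.apply_symm_apply] at h1
          have := hk j
          omega
        exact ⟨(a.symm ⟨s.symm j, hpos⟩, 1), by simp [F]⟩
  refine ⟨_, Equiv.ofBijective F hF, fun i => ?_⟩
  have := hs (a i)
  simp only [Equiv.ofBijective_apply, F, if_true, one_ne_zero, if_false]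
  omega

/-- If `k₁,…,kₙ` are nonzero integers whose odd power sums
`k₁^{2l+1}+⋯+kₙ^{2l+1}` vanish for every `l = 0,…,n−1`, then `n` is even and the
tuple is paired by a permutation `σ` with `k_{σ(2j)} + k_{σ(2j+1)} = 0` (0-based). -/
theorem stmt0 (n : ℕ) (hn : 1 ≤ n) (k : Fin n → ℤ)
    (hk : ∀ j, k j ≠ 0)
    (hres : ∀ l < n, ∑ j, k j ^ (2 * l + 1) = 0) :
    (∃ m, n = 2 * m) ∧
      ∃ σ : Equiv.Perm (Fin n), ∀ (j : ℕ) (h1 : 2 * j < n) (h2 : 2 * j + 1 < n),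
        k (σ ⟨2 * j, h1⟩) + k (σ ⟨2 * j + 1, h2⟩) = 0 := by
  obtain ⟨m, e, he⟩ := exists_equiv_prod_fin_two k hk fun v hv =>
    card_fiber_eq_card_fiber_neg k (by simpa using hres) hv
  have hm : n = m * 2 := by simpa using (Fintype.card_congr e).symm
  refine ⟨⟨m, by omega⟩, (finCongr hm).trans (finProdFinEquiv.symm.trans e), fun j h1 h2 => ?_⟩
  have hj : j < m := by omega
  have e0 : finProdFinEquiv.symm (finCongr hm ⟨2 * j, h1⟩) = (⟨j, hj⟩, 0) := by
    rw [Equiv.symm_apply_eq]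
    ext
    simp
  have e1 : finProdFinEquiv.symm (finCongr hm ⟨2 * j + 1, h2⟩) = (⟨j, hj⟩, 1) := by
    rw [Equiv.symm_apply_eq]
    ext
    simp [add_comm]
  simp only [Equiv.trans_apply, e0, e1]
  exact he ⟨j, hj⟩
end

section
/- Let n ≥ 1, let α_1, …, α_n be positive natural numbers and k_1, …, k_n nonzero integers satisfying α_1 k_1^{2l+1} + α_2 k_2^{2l+1} + ⋯ + α_n k_n^{2l+1} = 0 for every l = 0, 1, …, n−1. Set S = α_1 + ⋯ + α_n. Then S is even and the solution is weightedly paired: for every integer a, the total weight Σ_{j : k_j = a} α_j equals Σ_{j : k_j = −a} α_j. In particular, if S is odd there is no such tuple. -/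
open Polynomial in
/-- Vanishing odd moments up to exponent `2n - 1` annihilate every odd polynomial `X * P(X²)`
with `deg P < n`. -/
theorem sum_mul_eval_sq_eq_zero {ι : Type*} [Fintype ι] {n : ℕ} {w k : ι → ℤ}
    (h : ∀ l < n, ∑ j, w j * k j ^ (2 * l + 1) = 0) {P : ℤ[X]} (hP : P.natDegree < n) :
    ∑ j, w j * k j * P.eval (k j ^ 2) = 0 := by
  simp_rw [eval_eq_sum_range' hP, Finset.mul_sum]
  rw [Finset.sum_comm]
  refine Finset.sum_eq_zero fun l hl => ?_
  calc ∑ j, w j * k j * (P.coeff l * (k j ^ 2) ^ l)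
      = P.coeff l * ∑ j, w j * k j ^ (2 * l + 1) := by
        rw [Finset.mul_sum]
        exact Finset.sum_congr rfl fun j _ => by ring
    _ = 0 := by rw [h l (Finset.mem_range.mp hl), mul_zero]

open Polynomial in
/-- Vanishing of the first `Fintype.card ι` odd moments localizes to each level set of `k ^ 2`. -/
theorem sum_filter_sq_eq_zero {ι : Type*} [Fintype ι] {w k : ι → ℤ}
    (h : ∀ l < Fintype.card ι, ∑ j, w j * k j ^ (2 * l + 1) = 0) (b : ℤ) :
    ∑ j with k j ^ 2 = b, w j * k j = 0 := by
  classical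
  set T := Finset.univ.image fun j => k j ^ 2 with hT
  by_cases hb : b ∈ T
  swap
  · refine Finset.sum_eq_zero fun j hj => absurd ?_ hb
    rw [← (Finset.mem_filter.mp hj).2]
    exact Finset.mem_image_of_mem _ (Finset.mem_univ j)
  set P : ℤ[X] := ∏ c ∈ T.erase b, (X - C c) with hPdef
  have hdeg : P.natDegree < Fintype.card ι := by
    rw [hPdef, natDegree_finsetProd_X_sub_C_eq_card]
    exact (Finset.card_erase_lt_of_mem hb).trans_le Finset.card_image_le
  have heval (x : ℤ) : P.eval x = ∏ c ∈ T.erase b, (x - c) := by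
    simp [hPdef, eval_prod]
  have hPb : P.eval b ≠ 0 := by
    rw [heval, Finset.prod_ne_zero_iff]
    exact fun c hc => sub_ne_zero.mpr (Finset.ne_of_mem_erase hc).symm
  refine (mul_eq_zero.mp ?_).resolve_right hPb
  rw [← sum_mul_eval_sq_eq_zero h hdeg, Finset.sum_mul, Finset.sum_filter]
  refine Finset.sum_congr rfl fun j _ => ?_
  split_ifs with hj
  · rw [hj]
  · rw [heval, Finset.prod_eq_zero (i := k j ^ 2) _ (sub_self _), mul_zero]
    exact Finset.mem_erase.mpr ⟨hj, Finset.mem_image_of_mem _ (Finset.mem_univ j)⟩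

/-- A sum over the indices with `k j = ± a` splits into its two parts when `a ≠ 0`. -/
theorem sum_filter_sq_eq_sq {ι M : Type*} [Fintype ι] [AddCommMonoid M] (f : ι → M) (k : ι → ℤ)
    {a : ℤ} (ha : a ≠ 0) :
    ∑ j with k j ^ 2 = a ^ 2, f j = ∑ j with k j = a, f j + ∑ j with k j = -a, f j := by
  classical
  simp_rw [sq_eq_sq_iff_eq_or_eq_neg]
  rw [Finset.filter_or, Finset.sum_union]
  exact Finset.disjoint_filter.mpr fun j _ h₁ h₂ => ha (by lia)


/-- If `α₁,…,αₙ` are positive natural weights and `k₁,…,kₙ` nonzero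
integers with `α₁k₁^{2l+1}+⋯+αₙkₙ^{2l+1} = 0` for every `l = 0,…,n−1`, then
`S = α₁+⋯+αₙ` is even, and the solution is weightedly paired: for every integer `a`
the total weight of indices with `k_j = a` equals that of indices with `k_j = −a`. -/
theorem stmt1 (n : ℕ) (hn : 1 ≤ n) (α : Fin n → ℕ) (hα : ∀ j, 0 < α j)
    (k : Fin n → ℤ) (hk : ∀ j, k j ≠ 0)
    (hres : ∀ l < n, ∑ j, (α j : ℤ) * k j ^ (2 * l + 1) = 0) :
    Even (∑ j, α j) ∧
      ∀ a : ℤ, ∑ j ∈ Finset.univ.filter (fun j => k j = a), α j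
        = ∑ j ∈ Finset.univ.filter (fun j => k j = -a), α j := by
  have hpair (a : ℤ) : ∑ j with k j = a, α j = ∑ j with k j = -a, α j := by
    rcases eq_or_ne a 0 with rfl | ha
    · rw [neg_zero]
    have hsq := sum_filter_sq_eq_zero (w := fun j => (α j : ℤ)) (by simpa using hres) (a ^ 2)
    have hconst (c : ℤ) :
        ∑ j with k j = c, (α j : ℤ) * k j = (∑ j with k j = c, (α j : ℤ)) * c := by
      rw [Finset.sum_mul]
      exact Finset.sum_congr rfl fun j hj => by rw [(Finset.mem_filter.mp hj).2]
    rw [sum_filter_sq_eq_sq _ k ha, hconst, hconst, mul_neg, ← sub_eq_add_neg, ← sub_mul] at hsq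
    exact_mod_cast sub_eq_zero.mp ((mul_eq_zero.mp hsq).resolve_right ha)
  refine ⟨?_, hpair⟩
  rw [← Finset.sum_fiberwise_of_maps_to
    (fun j _ => Finset.mem_image_of_mem (fun j => k j ^ 2) (Finset.mem_univ j))]
  refine Finset.even_sum _ fun b hb => ?_
  obtain ⟨i, -, rfl⟩ := Finset.mem_image.mp hb
  rw [sum_filter_sq_eq_sq _ k (hk i), ← hpair]
  exact Even.add_self _
end

section
/- Let n ≥ 3, let l ≥ 1 be an integer, and let k = (k_1, …, k_n) be a tuple of nonzero integers with k_1 + ⋯ + k_n = 0, |k_1| ≥ |k_2| ≥ ⋯ ≥ |k_n|, and k_1 + k_2 ≠ 0. Then max( (n−2)^{2l} |k_3|^{2l+1} , |k_1^{2l+1} + ⋯ + k_n^{2l+1}| ) ≥ |k_1|^{2l} / 2. -/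
theorem pow_le_pow_odd_add_of_pos {x y : ℤ} (l : ℕ) (hx : 0 < x) (hy : 1 - x ≤ y) :
    x ^ (2 * l) ≤ x ^ (2 * l + 1) + y ^ (2 * l + 1) := by
  have hodd : Odd (2 * l + 1) := ⟨l, rfl⟩
  have h1 : (1 - x) ^ (2 * l + 1) ≤ y ^ (2 * l + 1) := hodd.strictMono_pow.monotone hy
  have h2 : (x - 1) ^ (2 * l) ≤ x ^ (2 * l) := pow_le_pow_left₀ (by omega) (by omega) _
  have h3 : (1 - x) ^ (2 * l + 1) = -((x - 1) ^ (2 * l) * (x - 1)) := by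
    rw [← neg_sub x 1, hodd.neg_pow, pow_succ]
  have h4 : (x - 1) ^ (2 * l) * (x - 1) ≤ x ^ (2 * l) * (x - 1) :=
    mul_le_mul_of_nonneg_right h2 (by omega)
  rw [pow_succ x]
  linarith

theorem abs_pow_le_abs_pow_odd_add {x y : ℤ} (l : ℕ) (hyx : |y| ≤ |x|) (hxy : x + y ≠ 0) :
    |x| ^ (2 * l) ≤ |x ^ (2 * l + 1) + y ^ (2 * l + 1)| := by
  have hodd : Odd (2 * l + 1) := ⟨l, rfl⟩
  rcases le_or_gt x 0 with hx | hx
  · rw [abs_of_nonpos hx, abs_le] at *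
    have h := pow_le_pow_odd_add_of_pos (x := -x) (y := -y) l (by omega) (by omega)
    rw [hodd.neg_pow, hodd.neg_pow] at h
    rw [← abs_neg, neg_add]
    exact h.trans (le_abs_self _)
  · rw [abs_of_pos hx, abs_le] at *
    exact (pow_le_pow_odd_add_of_pos l hx (by omega)).trans (le_abs_self _)

theorem abs_sum_pow_le {ι : Type*} (s : Finset ι) (k : ι → ℤ) {c : ℤ} (p : ℕ)
    (hk : ∀ i ∈ s, |k i| ≤ c) : |∑ i ∈ s, k i ^ p| ≤ s.card * c ^ p := by
  refine (Finset.abs_sum_le_sum_abs _ _).trans ?_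
  rw [← nsmul_eq_mul]
  refine Finset.sum_le_card_nsmul _ _ _ fun i hi => ?_
  rw [abs_pow]
  exact pow_le_pow_left₀ (abs_nonneg _) (hk i hi) p

/-- For a zero-momentum tuple of nonzero integers, ordered by
decreasing absolute value and with `k₁ + k₂ ≠ 0`, one has
`max((n−2)^{2l}|k₃|^{2l+1}, |k₁^{2l+1}+⋯+kₙ^{2l+1}|) ≥ |k₁|^{2l}/2`. -/
theorem stmt2 (n : ℕ) (hn : 3 ≤ n) (l : ℕ) (hl : 1 ≤ l) (k : Fin n → ℤ)
    (hk0 : ∀ i, k i ≠ 0) (hsum : ∑ i, k i = 0)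
    (hsort : ∀ i j : Fin n, i ≤ j → |k j| ≤ |k i|)
    (h12 : k ⟨0, by omega⟩ + k ⟨1, by omega⟩ ≠ 0) :
    ((|k ⟨0, by omega⟩| : ℝ)) ^ (2 * l) / 2 ≤
      max (((n : ℝ) - 2) ^ (2 * l) * ((|k ⟨2, by omega⟩| : ℝ)) ^ (2 * l + 1))
        ((|∑ i, k i ^ (2 * l + 1)| : ℝ)) := by
  obtain ⟨m, rfl⟩ : ∃ m, n = m + 2 := ⟨n - 2, by omega⟩
  have hpair := abs_pow_le_abs_pow_odd_add l
    (hsort ⟨0, by omega⟩ ⟨1, by omega⟩ (by simp)) h12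
  have hrest := abs_sum_pow_le Finset.univ (fun i : Fin m => k i.succ.succ)
    (c := |k ⟨2, by omega⟩|) (2 * l + 1) fun i _ => hsort _ _ (by simp [Fin.le_def])
  have hm : (m : ℤ) ≤ (m : ℤ) ^ (2 * l) := le_self_pow₀ (by omega) (by omega)
  have hsplit : ∑ i, k i ^ (2 * l + 1) =
      (k ⟨0, by omega⟩ ^ (2 * l + 1) + k ⟨1, by omega⟩ ^ (2 * l + 1)) +
        ∑ i : Fin m, k i.succ.succ ^ (2 * l + 1) := by
    rw [Fin.sum_univ_succ, Fin.sum_univ_succ, ← add_assoc]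
    rfl
  rw [Finset.card_univ, Fintype.card_fin] at hrest
  have hrest' := hrest.trans (mul_le_mul_of_nonneg_right hm (by positivity))
  have htri := abs_sub (∑ i, k i ^ (2 * l + 1)) (∑ i : Fin m, k i.succ.succ ^ (2 * l + 1))
  rw [hsplit, add_sub_cancel_right, ← hsplit] at htri
  have key : |k ⟨0, by omega⟩| ^ (2 * l) ≤ (m : ℤ) ^ (2 * l) * |k ⟨2, by omega⟩| ^ (2 * l + 1) +
      |∑ i, k i ^ (2 * l + 1)| := by linarith
  have keyR : (|k ⟨0, by omega⟩| : ℝ) ^ (2 * l) ≤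
      (m : ℝ) ^ (2 * l) * (|k ⟨2, by omega⟩| : ℝ) ^ (2 * l + 1) +
        |∑ i, (k i : ℝ) ^ (2 * l + 1)| := by exact_mod_cast key
  rw [Nat.cast_add, Nat.cast_ofNat, add_sub_cancel_right]
  rcases le_total ((m : ℝ) ^ (2 * l) * (|k ⟨2, by omega⟩| : ℝ) ^ (2 * l + 1))
    |∑ i, (k i : ℝ) ^ (2 * l + 1)| with h | h
  · exact le_max_of_le_right (by linarith)
  · exact le_max_of_le_left (by linarith)
end

section
/- Let n ≥ 3, let l ≥ 1 be an integer, let N > 2 be real, and let k ∈ D_n satisfy Ω_l(k) ≠ 0 and |k_1|^{2l−1} ≥ N |Ω_l(k)|. Then either k_1 + k_2 = 0 and |k_1| ≥ N^{1/(2l−1)}, or |k_3|^{2l+1} ≥ N^{2l/(2l−1)} / (2 (n−2)^{2l}). -/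
lemma pow_le_odd_pow_add_of_pos (x y : ℤ) (hx : 0 < x) (hyx : |y| ≤ x) (hxy : x + y ≠ 0)
    (l : ℕ) : x ^ (2 * l) ≤ x ^ (2 * l + 1) + y ^ (2 * l + 1) := by
  have hp : 0 < x ^ (2 * l) := by positivity
  rw [pow_succ x, pow_succ y]
  have hsq : y ^ (2 * l) ≤ x ^ (2 * l) := by
    rw [← (even_two_mul l).pow_abs y]
    exact pow_le_pow_left₀ (abs_nonneg y) hyx _
  have hy0 : 0 ≤ y ^ (2 * l) := (even_two_mul l).pow_nonneg y
  rcases le_or_gt 0 y with hy | hy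
  · nlinarith [mul_nonneg hy0 hy]
  · have hlt : 1 ≤ x + y := by
      rw [abs_of_neg hy] at hyx
      omega
    nlinarith

lemma abs_pow_le_abs_odd_pow_add (x y : ℤ) (hx : x ≠ 0) (hyx : |y| ≤ |x|) (hxy : x + y ≠ 0)
    (l : ℕ) : |x| ^ (2 * l) ≤ |x ^ (2 * l + 1) + y ^ (2 * l + 1)| := by
  rcases hx.lt_or_gt with h | h
  · rw [abs_of_neg h] at hyx ⊢
    have key := pow_le_odd_pow_add_of_pos (-x) (-y) (by omega) (by rwa [abs_neg])
      (by omega) l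
    have hodd : Odd (2 * l + 1) := odd_two_mul_add_one l
    rw [hodd.neg_pow, hodd.neg_pow, ← neg_add] at key
    exact key.trans (neg_le_abs _)
  · rw [abs_of_pos h] at hyx ⊢
    exact (pow_le_odd_pow_add_of_pos x y h hyx hxy l).trans (le_abs_self _)

/-- The lower bound for the third entry when the two leading entries do not cancel: here `a`, `c`
are the sizes of the first and third entries, `s` is the resonance function and `m` is the number
of remaining entries. -/
lemma rpow_div_le_pow_of_resonance_le {a c s N m : ℝ} {l : ℕ} (hl : 1 ≤ l) (hN : 2 < N)
    (ha : 1 ≤ a) (hm : 1 ≤ m) (hNa : N ^ ((1 : ℝ) / (2 * (l : ℝ) - 1)) ≤ a)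
    (hs : N * s ≤ a ^ (2 * l - 1)) (h : a ^ (2 * l) ≤ s + m * c ^ (2 * l + 1)) :
    N ^ ((2 * (l : ℝ)) / (2 * (l : ℝ) - 1)) / (2 * m ^ (2 * l)) ≤ c ^ (2 * l + 1) := by
  have hN0 : 0 ≤ N := by linarith
  have hpow : N ^ ((2 * (l : ℝ)) / (2 * (l : ℝ) - 1)) ≤ a ^ (2 * l) := by
    calc N ^ ((2 * (l : ℝ)) / (2 * (l : ℝ) - 1))
        = (N ^ ((1 : ℝ) / (2 * (l : ℝ) - 1))) ^ (2 * l) := by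
          rw [← Real.rpow_mul_natCast hN0]
          push_cast
          ring_nf
      _ ≤ a ^ (2 * l) := pow_le_pow_left₀ (Real.rpow_nonneg hN0 _) hNa _
  have hle : a ^ (2 * l - 1) ≤ a ^ (2 * l) := pow_le_pow_right₀ ha (Nat.sub_le _ _)
  have hs2 : 2 * s ≤ a ^ (2 * l) := by
    rcases le_or_gt s 0 with h0 | h0
    · have : 0 ≤ a ^ (2 * l) := by positivity
      linarith
    · nlinarith
  have hmc : a ^ (2 * l) ≤ 2 * m * c ^ (2 * l + 1) := by linarith
  have hm' : m ≤ m ^ (2 * l) := le_self_pow₀ hm (by omega)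
  have hc : 0 ≤ c ^ (2 * l + 1) := by
    have : 0 < a ^ (2 * l) := by positivity
    by_contra! hc
    nlinarith
  rw [div_le_iff₀ (by positivity)]
  nlinarith [mul_le_mul_of_nonneg_right hm' hc]


/-- If `k ∈ D_n` satisfies `Ω_l(k) ≠ 0` and `|k₁|^{2l−1} ≥ N|Ω_l(k)|`
with `N > 2`, then either `k₁ + k₂ = 0` and `|k₁| ≥ N^{1/(2l−1)}`, or
`|k₃|^{2l+1} ≥ N^{2l/(2l−1)}/(2(n−2)^{2l})`. -/
theorem stmt3 (n : ℕ) (hn : 3 ≤ n) (l : ℕ) (hl : 1 ≤ l) (N : ℝ) (hN : 2 < N)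
    (k : Fin n → ℤ) (hk0 : ∀ i, k i ≠ 0) (hsum : ∑ i, k i = 0)
    (hsort : ∀ i j : Fin n, i ≤ j → |k j| ≤ |k i|)
    (hres : (∑ i, k i ^ (2 * l + 1)) ≠ 0)
    (hbig : N * ((|∑ i, k i ^ (2 * l + 1)| : ℝ)) ≤ ((|k ⟨0, by omega⟩| : ℝ)) ^ (2 * l - 1)) :
    (k ⟨0, by omega⟩ + k ⟨1, by omega⟩ = 0 ∧
        N ^ ((1 : ℝ) / (2 * (l : ℝ) - 1)) ≤ (|k ⟨0, by omega⟩| : ℝ)) ∨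
      N ^ ((2 * (l : ℝ)) / (2 * (l : ℝ) - 1)) / (2 * ((n : ℝ) - 2) ^ (2 * l))
        ≤ ((|k ⟨2, by omega⟩| : ℝ)) ^ (2 * l + 1) := by
  obtain ⟨m, rfl⟩ : ∃ m, n = m + 3 := ⟨n - 3, by omega⟩
  set x : ℤ := k ⟨0, by omega⟩
  set y : ℤ := k ⟨1, by omega⟩
  set z : ℤ := k ⟨2, by omega⟩
  have hx0 : x ≠ 0 := hk0 _
  have hx1 : (1 : ℝ) ≤ |(x : ℝ)| := by exact_mod_cast Int.one_le_abs hx0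
  have hS1 : (1 : ℝ) ≤ |∑ i, (k i : ℝ) ^ (2 * l + 1)| := by
    exact_mod_cast Int.one_le_abs hres
  have hl' : (1 : ℝ) ≤ l := by exact_mod_cast hl
  have hNx : N ^ ((1 : ℝ) / (2 * (l : ℝ) - 1)) ≤ |(x : ℝ)| := by
    have hcast : (2 * (l : ℝ) - 1) = ((2 * l - 1 : ℕ) : ℝ) := by
      rw [Nat.cast_sub (by omega)]
      push_cast
      ring
    rw [hcast, one_div, Real.rpow_inv_le_iff_of_pos (by linarith) (abs_nonneg _)
      (by rw [← hcast]; linarith), Real.rpow_natCast]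
    nlinarith
  by_cases hxy : x + y = 0
  · exact Or.inl ⟨hxy, hNx⟩
  right
  have htail : |∑ i : Fin (m + 1), k i.succ.succ ^ (2 * l + 1)|
      ≤ ((m : ℤ) + 1) * |z| ^ (2 * l + 1) := by
    refine (Finset.abs_sum_le_sum_abs _ _).trans ?_
    have hi : ∀ i ∈ (Finset.univ : Finset (Fin (m + 1))),
        |k i.succ.succ ^ (2 * l + 1)| ≤ |z| ^ (2 * l + 1) := fun i _ ↦ by
      rw [abs_pow]
      refine pow_le_pow_left₀ (abs_nonneg _) (hsort _ _ ?_) _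
      simp [Fin.le_def]
    simpa using Finset.sum_le_card_nsmul _ _ _ hi
  have hsplit : ∑ i, k i ^ (2 * l + 1) = x ^ (2 * l + 1) + y ^ (2 * l + 1)
      + ∑ i : Fin (m + 1), k i.succ.succ ^ (2 * l + 1) := by
    rw [Fin.sum_univ_succ, Fin.sum_univ_succ, ← add_assoc]
    rfl
  have hlead := abs_pow_le_abs_odd_pow_add x y hx0 (hsort _ _ (by simp)) hxy l
  have hbound : |x| ^ (2 * l)
      ≤ |∑ i, k i ^ (2 * l + 1)| + ((m : ℤ) + 1) * |z| ^ (2 * l + 1) := by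
    rw [eq_sub_of_add_eq hsplit.symm] at hlead
    exact hlead.trans ((abs_sub _ _).trans (by gcongr))
  have hbound' : |(x : ℝ)| ^ (2 * l)
      ≤ |∑ i, (k i : ℝ) ^ (2 * l + 1)| + ((m : ℝ) + 1) * |(z : ℝ)| ^ (2 * l + 1) := by
    exact_mod_cast hbound
  have hm : (((m + 3 : ℕ) : ℝ) - 2) = (m : ℝ) + 1 := by
    push_cast
    ring
  rw [hm]
  exact rpow_div_le_pow_of_resonance_le hl hN hx1 (by simp) hNx hbig hbound'
end

section
/- For every n ≥ 3 there exists N_0 = N_0(n) ≥ 1 such that for all real N ≥ N_0 one has the disjoint decomposition M_n \ (⋃_{l=1}^{n−1} J_{n,l,N}) = R_n ∪ C_{n,N}, where R_n = ⋂_{l=1}^{n−1} R_n^l, C_{n,N} = (M_n^{(μ3 ≥ N^{1/(2n)})} ∪ M_n^{(I ≥ N^{1/(2n)})}) \ R_n, and R_n ∩ C_{n,N} = ∅. Moreover R_n = ∅ when n is odd, and when n is even every k ∈ R_n is paired: there exists a permutation σ of {1,…,n} with k_{σ(2j−1)} + k_{σ(2j)} = 0 for j = 1, …, n/2. -/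
/-- `M_n`: zero-momentum tuples of nonzero integers. -/
def Mset (n : ℕ) : Set (Fin n → ℤ) := {k | (∀ i, k i ≠ 0) ∧ ∑ i, k i = 0}

/-- `Ω_l(k) = k₁^{2l+1} + ⋯ + kₙ^{2l+1}`. -/
def omegaRes (l : ℕ) {n : ℕ} (k : Fin n → ℤ) : ℤ := ∑ i, k i ^ (2 * l + 1)

/-- `R_n^l`: the `l`-resonant tuples in `M_n`. -/
def Rres (n l : ℕ) : Set (Fin n → ℤ) := {k | k ∈ Mset n ∧ omegaRes l k = 0}

/-- `‖k‖_∞ = max_i |k_i|`. -/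
def normInf {n : ℕ} (k : Fin n → ℤ) : ℕ := Finset.univ.sup fun i => (k i).natAbs

/-- `M_n^{(μ₃ ≥ M)}`: tuples in `M_n` whose third largest absolute value is `≥ M`,
i.e. having three distinct indices with `|k_i| ≥ M`. -/
def mu3Set (n : ℕ) (M : ℝ) : Set (Fin n → ℤ) :=
  {k | k ∈ Mset n ∧ ∃ i j h : Fin n, i ≠ j ∧ i ≠ h ∧ j ≠ h ∧
    M ≤ ((k i).natAbs : ℝ) ∧ M ≤ ((k j).natAbs : ℝ) ∧ M ≤ ((k h).natAbs : ℝ)}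

/-- `M_n^{(I ≥ M)}`: tuples in `M_n` containing a pair `k_i = −k_j` with `|k_i| ≥ M`. -/
def actSet (n : ℕ) (M : ℝ) : Set (Fin n → ℤ) :=
  {k | k ∈ Mset n ∧ ∃ i j : Fin n, i ≠ j ∧ k i = -k j ∧ M ≤ ((k i).natAbs : ℝ)}

/-- The set `J_{n,l,N}`. -/
noncomputable def Jset (n l : ℕ) (N : ℝ) : Set (Fin n → ℤ) :=
  {k | k ∈ Mset n ∧ omegaRes l k ≠ 0 ∧
      ((normInf k : ℝ)) ^ (2 * l - 1) ≤ N * (((omegaRes l k).natAbs : ℝ))}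
    \ (mu3Set n (N ^ ((1 : ℝ) / (2 * n))) ∪ actSet n (N ^ ((1 : ℝ) / (2 * n))))

/-- If the first `n` odd power sums of an integer `n`-tuple vanish, then so does
`∑ kᵢ q(kᵢ²)` for every polynomial `q` of degree less than `n`. -/
lemma sum_mul_eval_sq_eq_zero_s5 {n : ℕ} {k : Fin n → ℤ} (h : ∀ l < n, omegaRes l k = 0)
    {q : Polynomial ℤ} (hq : q.natDegree < n) : ∑ i, k i * q.eval (k i ^ 2) = 0 := by
  simp_rw [Polynomial.eval_eq_sum_range' hq, Finset.mul_sum]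
  rw [Finset.sum_comm]
  refine Finset.sum_eq_zero fun l hl => ?_
  have h0 := h l (Finset.mem_range.1 hl)
  calc ∑ i, k i * (q.coeff l * (k i ^ 2) ^ l) = q.coeff l * omegaRes l k := by
        rw [omegaRes, Finset.mul_sum]
        refine Finset.sum_congr rfl fun i _ => ?_
        ring
    _ = 0 := by rw [h0, mul_zero]

/-- If the first `n` odd power sums of an integer `n`-tuple vanish, then every nonzero value is
taken as often as its negative. -/
lemma card_filter_eq_card_filter_neg {n : ℕ} {k : Fin n → ℤ} (h : ∀ l < n, omegaRes l k = 0)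
    {v : ℤ} (hv : v ≠ 0) :
    (Finset.univ.filter fun i => k i = v).card = (Finset.univ.filter fun i => k i = -v).card := by
  classical
  set S : Finset ℤ := Finset.univ.image fun i => k i ^ 2
  by_cases hS : v ^ 2 ∈ S
  · set q : Polynomial ℤ := ∏ w ∈ S.erase (v ^ 2), (Polynomial.X - Polynomial.C w) with hqdef
    have hdeg : q.natDegree < n := by
      rw [hqdef, Polynomial.natDegree_finsetProd_X_sub_C_eq_card]
      calc (S.erase (v ^ 2)).card < S.card := Finset.card_erase_lt_of_mem hS
        _ ≤ (Finset.univ : Finset (Fin n)).card := Finset.card_image_le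
        _ = n := by simp
    have hqv : q.eval (v ^ 2) ≠ 0 := by
      rw [hqdef, Polynomial.eval_prod, Finset.prod_ne_zero_iff]
      intro w hw
      simpa [sub_eq_zero] using (Finset.ne_of_mem_erase hw).symm
    have hterm : ∀ i, k i * q.eval (k i ^ 2) =
        q.eval (v ^ 2) * v * ((if k i = v then 1 else 0) - (if k i = -v then 1 else 0)) := by
      intro i
      by_cases h1 : k i = v
      · have h2 : k i ≠ -v := by omega
        rw [if_pos h1, if_neg h2, h1]
        ring
      · by_cases h2 : k i = -v
        · rw [if_neg h1, if_pos h2, h2, neg_sq]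
          ring
        · have h3 : k i ^ 2 ≠ v ^ 2 := by
            rw [Ne, sq_eq_sq_iff_eq_or_eq_neg]
            tauto
          have h4 : q.eval (k i ^ 2) = 0 := by
            rw [hqdef, Polynomial.eval_prod]
            refine Finset.prod_eq_zero (i := k i ^ 2) ?_ (by simp)
            exact Finset.mem_erase.2 ⟨h3, Finset.mem_image_of_mem _ (Finset.mem_univ i)⟩
          simp [h1, h2, h4]
    have hsum := sum_mul_eval_sq_eq_zero_s5 h hdeg
    simp_rw [hterm] at hsum
    rw [← Finset.mul_sum, Finset.sum_sub_distrib, Finset.sum_boole, Finset.sum_boole] at hsum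
    have := (mul_eq_zero.1 hsum).resolve_left (mul_ne_zero hqv hv)
    exact_mod_cast sub_eq_zero.1 this
  · have hne : ∀ i, k i ^ 2 ≠ v ^ 2 := fun i hi =>
      hS (hi ▸ Finset.mem_image_of_mem _ (Finset.mem_univ i))
    rw [Finset.filter_false_of_mem fun i _ hi => hne i (by rw [hi]),
      Finset.filter_false_of_mem fun i _ hi => hne i (by rw [hi, neg_sq])]

/-- An integer `n`-tuple whose first `n` odd power sums vanish is a permutation of its
negative. -/
lemma exists_perm_apply_eq_neg {n : ℕ} {k : Fin n → ℤ} (h : ∀ l < n, omegaRes l k = 0) :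
    ∃ τ : Equiv.Perm (Fin n), ∀ i, k (τ i) = -k i := by
  have hcard : ∀ v, Fintype.card {i // -k i = v} = Fintype.card {i // k i = v} := by
    intro v
    rw [Fintype.card_subtype, Fintype.card_subtype]
    simp only [neg_eq_iff_eq_neg]
    rcases eq_or_ne v 0 with rfl | hv
    · rw [neg_zero]
    · exact (card_filter_eq_card_filter_neg h hv).symm
  exact ⟨Equiv.ofFiberEquiv fun v => Fintype.equivOfCardEq (hcard v),
    fun i => Equiv.ofFiberEquiv_map (f := fun i => -k i) _ i⟩

/-- A nonvanishing tuple which is a permutation of its negative has even length and can be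
arranged in pairs of opposite entries. -/
lemma exists_pairing {n : ℕ} {k : Fin n → ℤ} (h0 : ∀ i, k i ≠ 0) {τ : Equiv.Perm (Fin n)}
    (hτ : ∀ i, k (τ i) = -k i) :
    Even n ∧ ∃ σ : Equiv.Perm (Fin n), ∀ (j : ℕ) (h1 : 2 * j < n) (h2 : 2 * j + 1 < n),
      k (σ ⟨2 * j, h1⟩) + k (σ ⟨2 * j + 1, h2⟩) = 0 := by
  classical
  set P : Finset (Fin n) := Finset.univ.filter fun i => 0 < k i with hP
  have hcard : Pᶜ.card = P.card := by
    refine (Finset.card_equiv τ fun i => ?_).symm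
    have := h0 i
    simp only [hP, Finset.mem_filter_univ, Finset.mem_compl, hτ]
    omega
  have hn : P.card * 2 = n := by
    have := Finset.card_add_card_compl P
    rw [Fintype.card_fin] at this
    omega
  let p : Fin P.card → Fin n := fun j => P.equivFin.symm j
  have hp : ∀ j, 0 < k (p j) := fun j => (Finset.mem_filter.1 (P.equivFin.symm j).2).2
  have hpinj : Function.Injective p := Subtype.val_injective.comp P.equivFin.symm.injective
  let f : Fin P.card × Fin 2 → Fin n := fun x => if x.2 = 0 then p x.1 else τ (p x.1)
  have hfinj : Function.Injective f := by
    rintro ⟨a, b⟩ ⟨c, d⟩ hf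
    have ha := hp a
    have hc := hp c
    have hk := congrArg k hf
    fin_cases b <;> fin_cases d <;> simp [f, hτ] at hf hk ⊢
    · exact hpinj hf
    · omega
    · omega
    · exact hpinj hf
  have hfbij : Function.Bijective f :=
    (Fintype.bijective_iff_injective_and_card f).2 ⟨hfinj, by simpa using hn⟩
  refine ⟨⟨P.card, by omega⟩,
    (finCongr hn.symm).trans (finProdFinEquiv.symm.trans (Equiv.ofBijective f hfbij)), ?_⟩
  intro j h1 h2
  have hj : j < P.card := by omega
  have e1 : finProdFinEquiv.symm (finCongr hn.symm ⟨2 * j, h1⟩) = (⟨j, hj⟩, (0 : Fin 2)) := by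
    rw [Equiv.symm_apply_eq]
    ext
    simp
  have e2 : finProdFinEquiv.symm (finCongr hn.symm ⟨2 * j + 1, h2⟩) = (⟨j, hj⟩, (1 : Fin 2)) := by
    rw [Equiv.symm_apply_eq]
    ext
    simp [add_comm]
  simp only [Equiv.trans_apply, e1, e2, Equiv.ofBijective_apply]
  simp [f, hτ]

lemma pow_le_abs_pow_sub_pow {a b : ℤ} (ha : 0 ≤ a) (hb : 0 ≤ b) (hab : a ≠ b) (m : ℕ) :
    a ^ m ≤ |a ^ (m + 1) - b ^ (m + 1)| := by
  rcases lt_or_gt_of_ne hab with h | h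
  · have h1 : a ^ m ≤ b ^ m := pow_le_pow_left₀ ha h.le m
    have h2 : 0 ≤ a ^ m := pow_nonneg ha m
    rw [abs_sub_comm]
    refine le_trans ?_ (le_abs_self _)
    rw [pow_succ, pow_succ]
    nlinarith
  · have h1 : b ^ m ≤ a ^ m := pow_le_pow_left₀ hb h.le m
    have h2 : 0 ≤ b ^ m := pow_nonneg hb m
    refine le_trans ?_ (le_abs_self _)
    rw [pow_succ, pow_succ]
    nlinarith

lemma abs_pow_le_abs_odd_pow_add_odd_pow {x y : ℤ} (hxy : x + y ≠ 0) (l : ℕ) :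
    |x| ^ (2 * l) ≤ |x ^ (2 * l + 1) + y ^ (2 * l + 1)| := by
  wlog hx : 0 ≤ x generalizing x y
  · have := this (x := -x) (y := -y) (by omega) (by omega)
    have hodd : Odd (2 * l + 1) := odd_two_mul_add_one l
    rwa [abs_neg, hodd.neg_pow, hodd.neg_pow, ← neg_add, abs_neg] at this
  rw [abs_of_nonneg hx]
  rcases le_total 0 y with hy | hy
  · have h1 : 0 ≤ y ^ (2 * l + 1) := pow_nonneg hy _
    rcases hx.eq_or_lt with rfl | hx
    · have hy' : 1 ≤ y := by omega
      have h2 : 1 ≤ y ^ (2 * l + 1) := one_le_pow₀ hy'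
      rw [zero_pow (by omega : 2 * l + 1 ≠ 0), zero_add, abs_of_nonneg h1]
      exact (pow_le_one₀ le_rfl zero_le_one).trans h2
    · have h3 : x ^ (2 * l) ≤ x ^ (2 * l + 1) := pow_le_pow_right₀ hx (by omega)
      exact (by linarith : x ^ (2 * l) ≤ x ^ (2 * l + 1) + y ^ (2 * l + 1)).trans (le_abs_self _)
  · have := pow_le_abs_pow_sub_pow hx (neg_nonneg.2 hy) (by omega) (2 * l)
    rwa [(odd_two_mul_add_one l).neg_pow, sub_neg_eq_add] at this

lemma natAbs_le_normInf {n : ℕ} (k : Fin n → ℤ) (i : Fin n) : (k i).natAbs ≤ normInf k :=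
  Finset.le_sup (f := fun i => (k i).natAbs) (Finset.mem_univ i)

lemma exists_natAbs_eq_normInf {n : ℕ} (hn : 0 < n) (k : Fin n → ℤ) :
    ∃ i, (k i).natAbs = normInf k := by
  have : Nonempty (Fin n) := ⟨⟨0, hn⟩⟩
  obtain ⟨i, -, hi⟩ := Finset.exists_mem_eq_sup (Finset.univ : Finset (Fin n))
    Finset.univ_nonempty fun i => (k i).natAbs
  exact ⟨i, hi.symm⟩

/-- A zero-sum tuple with an entry of size at least `n * M` has another entry of size at
least `M`. -/
lemma exists_ne_le_natAbs {n : ℕ} {k : Fin n → ℤ} (hk : ∑ i, k i = 0) {M : ℝ} (hM : 0 < M)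
    {i : Fin n} (hi : n * M ≤ ((k i).natAbs : ℝ)) : ∃ j, i ≠ j ∧ M ≤ ((k j).natAbs : ℝ) := by
  by_contra! hcon
  have h1 : (k i : ℝ) = -∑ j ∈ Finset.univ.erase i, (k j : ℝ) := by
    have := Finset.add_sum_erase Finset.univ (fun j => (k j : ℝ)) (Finset.mem_univ i)
    have h2 : ∑ j, (k j : ℝ) = 0 := by exact_mod_cast hk
    linarith
  have h2 : ((k i).natAbs : ℝ) ≤ (n - 1) * M := by
    rw [Nat.cast_natAbs, Int.cast_abs, h1, abs_neg]
    calc |∑ j ∈ Finset.univ.erase i, (k j : ℝ)|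
        ≤ ∑ j ∈ Finset.univ.erase i, |(k j : ℝ)| := Finset.abs_sum_le_sum_abs _ _
      _ ≤ ∑ j ∈ Finset.univ.erase i, M := by
          refine Finset.sum_le_sum fun j hj => ?_
          have := hcon j (Finset.ne_of_mem_erase hj).symm
          rw [Nat.cast_natAbs, Int.cast_abs] at this
          exact this.le
      _ = (n - 1) * M := by
          have hn : 1 ≤ n := i.pos
          rw [Finset.sum_const, Finset.card_erase_of_mem (Finset.mem_univ i), Finset.card_univ,
            Fintype.card_fin, nsmul_eq_mul, Nat.cast_sub hn, Nat.cast_one]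
  linarith

/-- If all entries but two non-opposite ones are at most `M` in size, then `Ω_l(k)` is bounded
below in terms of one of these two. -/
lemma pow_sub_le_natAbs_omegaRes {n : ℕ} {k : Fin n → ℤ} {M : ℝ} (hM : 0 ≤ M) {i j : Fin n}
    (hij : i ≠ j) (hne : k i + k j ≠ 0)
    (hrest : ∀ h, i ≠ h → j ≠ h → ((k h).natAbs : ℝ) ≤ M) (l : ℕ) :
    ((k i).natAbs : ℝ) ^ (2 * l) - n * M ^ (2 * l + 1) ≤ ((omegaRes l k).natAbs : ℝ) := by
  have hsplit : omegaRes l k = (k i ^ (2 * l + 1) + k j ^ (2 * l + 1)) +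
      ∑ h ∈ (Finset.univ.erase i).erase j, k h ^ (2 * l + 1) := by
    rw [omegaRes, ← Finset.add_sum_erase _ _ (Finset.mem_univ i),
      ← Finset.add_sum_erase (Finset.univ.erase i) _
        (Finset.mem_erase.2 ⟨hij.symm, Finset.mem_univ j⟩), add_assoc]
  have hmain : ((k i).natAbs : ℝ) ^ (2 * l) ≤
      |((k i : ℝ) ^ (2 * l + 1) + (k j : ℝ) ^ (2 * l + 1))| := by
    rw [Nat.cast_natAbs]
    exact_mod_cast abs_pow_le_abs_odd_pow_add_odd_pow hne l
  have herr : |∑ h ∈ (Finset.univ.erase i).erase j, (k h : ℝ) ^ (2 * l + 1)| ≤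
      n * M ^ (2 * l + 1) := by
    calc |∑ h ∈ (Finset.univ.erase i).erase j, (k h : ℝ) ^ (2 * l + 1)|
        ≤ ∑ h ∈ (Finset.univ.erase i).erase j, |(k h : ℝ) ^ (2 * l + 1)| :=
          Finset.abs_sum_le_sum_abs _ _
      _ ≤ ((Finset.univ.erase i).erase j).card • M ^ (2 * l + 1) := by
          refine Finset.sum_le_card_nsmul _ _ _ fun h hh => ?_
          have h1 := Finset.mem_erase.1 hh
          have h2 := Finset.mem_erase.1 h1.2
          have := hrest h h2.1.symm h1.1.symm
          rw [Nat.cast_natAbs, Int.cast_abs] at this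
          rw [abs_pow]
          exact pow_le_pow_left₀ (abs_nonneg _) this _
      _ ≤ n * M ^ (2 * l + 1) := by
          rw [nsmul_eq_mul]
          refine mul_le_mul_of_nonneg_right ?_ (pow_nonneg hM _)
          exact_mod_cast (Finset.card_le_univ _).trans_eq (Fintype.card_fin n)
  rw [Nat.cast_natAbs (omegaRes l k), Int.cast_abs, hsplit]
  simp only [Int.cast_add, Int.cast_sum, Int.cast_pow]
  have := abs_sub_abs_le_abs_add ((k i : ℝ) ^ (2 * l + 1) + (k j : ℝ) ^ (2 * l + 1))
    (∑ h ∈ (Finset.univ.erase i).erase j, (k h : ℝ) ^ (2 * l + 1))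
  linarith

/-- Outside the sets with large third entry or with a large cancelling pair, a tuple which is not
completely resonant satisfies one of the nonresonance conditions. -/
lemma exists_normInf_pow_le {n : ℕ} (hn : 3 ≤ n) {M : ℝ} (hM : (n : ℝ) ^ n ≤ M)
    {k : Fin n → ℤ} (hk : k ∈ Mset n) (h3 : k ∉ mu3Set n M) (hI : k ∉ actSet n M)
    {l₀ : ℕ} (hl₀ : l₀ ∈ Finset.Icc 1 (n - 1)) (hΩ : omegaRes l₀ k ≠ 0) :
    ∃ l ∈ Finset.Icc 1 (n - 1), omegaRes l k ≠ 0 ∧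
      (normInf k : ℝ) ^ (2 * l - 1) ≤ M ^ (2 * n) * ((omegaRes l k).natAbs : ℝ) := by
  obtain ⟨hl1, hl2⟩ := Finset.mem_Icc.1 hl₀
  have hn3 : (3 : ℝ) ≤ n := by exact_mod_cast hn
  have hnM : (n : ℝ) ≤ M := (le_self_pow₀ (by linarith) (by omega)).trans hM
  have hM0 : 0 < M := by linarith
  obtain ⟨i, hi⟩ := exists_natAbs_eq_normInf (by omega) k
  have hK1 : (1 : ℝ) ≤ normInf k := by
    rw [← hi]
    exact_mod_cast Int.natAbs_pos.2 (hk.1 i)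
  set K : ℝ := (normInf k : ℝ)
  by_cases hsmall : K ^ (2 * n - 3) ≤ M ^ (2 * n)
  · refine ⟨l₀, hl₀, hΩ, ?_⟩
    have h1 : (1 : ℝ) ≤ ((omegaRes l₀ k).natAbs : ℝ) := by exact_mod_cast Int.natAbs_pos.2 hΩ
    calc K ^ (2 * l₀ - 1) ≤ K ^ (2 * n - 3) := pow_le_pow_right₀ hK1 (by omega)
      _ ≤ M ^ (2 * n) := hsmall
      _ ≤ M ^ (2 * n) * ((omegaRes l₀ k).natAbs : ℝ) := le_mul_of_one_le_right (by positivity) h1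
  push Not at hsmall
  have hnMK : n * M ≤ K := by
    refine le_of_lt (lt_of_pow_lt_pow_left₀ (2 * n - 3) (by linarith) (lt_of_le_of_lt ?_ hsmall))
    calc (n * M) ^ (2 * n - 3) = (n : ℝ) ^ (2 * n - 3) * M ^ (2 * n - 3) := mul_pow _ _ _
      _ ≤ (n : ℝ) ^ (n * 3) * M ^ (2 * n - 3) := by
          refine mul_le_mul_of_nonneg_right (pow_le_pow_right₀ (by linarith) (by omega)) ?_
          positivity
      _ ≤ M ^ 3 * M ^ (2 * n - 3) := by
          refine mul_le_mul_of_nonneg_right ?_ (by positivity)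
          rw [pow_mul]
          exact pow_le_pow_left₀ (by positivity) hM 3
      _ = M ^ (2 * n) := by
          rw [← pow_add]
          congr 1
          omega
  have hiK : ((k i).natAbs : ℝ) = K := by rw [hi]
  have hMi : M ≤ ((k i).natAbs : ℝ) := by
    rw [hiK]
    nlinarith
  obtain ⟨j, hij, hMj⟩ := exists_ne_le_natAbs hk.2 hM0 (hnMK.trans_eq hiK.symm)
  have hne : k i + k j ≠ 0 := fun h => hI ⟨hk, i, j, hij, by omega, hMi⟩
  have hrest : ∀ h, i ≠ h → j ≠ h → ((k h).natAbs : ℝ) ≤ M := fun h hih hjh => by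
    by_contra! hlt
    exact h3 ⟨hk, i, j, h, hij, hih, hjh, hMi, hMj, hlt.le⟩
  have hlow := pow_sub_le_natAbs_omegaRes hM0.le hij hne hrest (n - 1)
  rw [hiK, show 2 * (n - 1) + 1 = 2 * n - 1 by omega,
    show 2 * (n - 1) = (2 * n - 3) + 1 by omega, pow_succ] at hlow
  have hX : M * M ^ (2 * n - 1) ≤ K ^ (2 * n - 3) := by
    rw [← pow_succ', show 2 * n - 1 + 1 = 2 * n by omega]
    exact hsmall.le
  have hY : (0 : ℝ) < M ^ (2 * n - 1) := by positivity
  have hXpos : 0 < K ^ (2 * n - 3) := by positivity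
  have hYX : n * M ^ (2 * n - 1) ≤ K ^ (2 * n - 3) :=
    (mul_le_mul_of_nonneg_right hnM hY.le).trans hX
  have hK2 : 2 ≤ K := by nlinarith
  have hfinal : K ^ (2 * n - 3) ≤ ((omegaRes (n - 1) k).natAbs : ℝ) := by nlinarith
  refine ⟨n - 1, Finset.mem_Icc.2 ⟨by omega, le_rfl⟩, ?_, ?_⟩
  · intro h
    rw [h] at hfinal
    simp at hfinal
    linarith
  · rw [show 2 * (n - 1) - 1 = 2 * n - 3 by omega]
    exact hfinal.trans (le_mul_of_one_le_left (by positivity) (one_le_pow₀ (by linarith)))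

lemma mem_iInter_Rres {n : ℕ} (hn : 2 ≤ n) {k : Fin n → ℤ} :
    k ∈ (⋂ l ∈ Finset.Icc 1 (n - 1), Rres n l) ↔
      k ∈ Mset n ∧ ∀ l ∈ Finset.Icc 1 (n - 1), omegaRes l k = 0 := by
  simp only [Set.mem_iInter]
  exact ⟨fun h => ⟨(h 1 (Finset.mem_Icc.2 ⟨le_rfl, by omega⟩)).1, fun l hl => (h l hl).2⟩,
    fun h l hl => ⟨h.1, h.2 l hl⟩⟩

/-- For every `n ≥ 3` there is `N₀(n) ≥ 1` such that for all `N ≥ N₀`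
one has the disjoint decomposition
`M_n \ ⋃_{l=1}^{n−1} J_{n,l,N} = R_n ∪ C_{n,N}` with `R_n = ⋂_{l=1}^{n−1} R_n^l`,
`C_{n,N} = (M_n^{(μ₃ ≥ N^{1/2n})} ∪ M_n^{(I ≥ N^{1/2n})}) \ R_n`, `R_n ∩ C_{n,N} = ∅`;
moreover `R_n = ∅` for odd `n`, and for even `n` every `k ∈ R_n` is paired. -/
theorem stmt5 (n : ℕ) (hn : 3 ≤ n) :
    ∃ N₀ : ℝ, 1 ≤ N₀ ∧ ∀ N : ℝ, N₀ ≤ N →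
      (Mset n \ ⋃ l ∈ Finset.Icc 1 (n - 1), Jset n l N)
          = (⋂ l ∈ Finset.Icc 1 (n - 1), Rres n l)
            ∪ ((mu3Set n (N ^ ((1 : ℝ) / (2 * n))) ∪ actSet n (N ^ ((1 : ℝ) / (2 * n))))
                \ ⋂ l ∈ Finset.Icc 1 (n - 1), Rres n l)
        ∧ ((⋂ l ∈ Finset.Icc 1 (n - 1), Rres n l)
            ∩ ((mu3Set n (N ^ ((1 : ℝ) / (2 * n))) ∪ actSet n (N ^ ((1 : ℝ) / (2 * n))))
                \ ⋂ l ∈ Finset.Icc 1 (n - 1), Rres n l) = ∅)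
        ∧ (Odd n → (⋂ l ∈ Finset.Icc 1 (n - 1), Rres n l) = ∅)
        ∧ (Even n → ∀ k ∈ ⋂ l ∈ Finset.Icc 1 (n - 1), Rres n l,
            ∃ σ : Equiv.Perm (Fin n), ∀ (j : ℕ) (h1 : 2 * j < n) (h2 : 2 * j + 1 < n),
              k (σ ⟨2 * j, h1⟩) + k (σ ⟨2 * j + 1, h2⟩) = 0) := by
  have hn0 : (1 : ℝ) ≤ n := by exact_mod_cast (by omega : 1 ≤ n)
  have hres : ∀ k ∈ ⋂ l ∈ Finset.Icc 1 (n - 1), Rres n l, Even n ∧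
      ∃ σ : Equiv.Perm (Fin n), ∀ (j : ℕ) (h1 : 2 * j < n) (h2 : 2 * j + 1 < n),
        k (σ ⟨2 * j, h1⟩) + k (σ ⟨2 * j + 1, h2⟩) = 0 := by
    intro k hk
    obtain ⟨hkM, hkΩ⟩ := (mem_iInter_Rres (by omega)).1 hk
    obtain ⟨τ, hτ⟩ := exists_perm_apply_eq_neg (k := k) fun l hl => by
      rcases Nat.eq_zero_or_pos l with rfl | hl0
      · simpa [omegaRes] using hkM.2
      · exact hkΩ l (Finset.mem_Icc.2 ⟨hl0, by omega⟩)
    exact exists_pairing hkM.1 hτ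
  refine ⟨((n : ℝ) ^ n) ^ (2 * n), one_le_pow₀ (one_le_pow₀ hn0), fun N hN =>
    ⟨?_, Set.inter_sdiff_self _ _, fun hodd => Set.eq_empty_of_forall_notMem fun k hk =>
      Nat.not_even_iff_odd.2 hodd (hres k hk).1, fun _ k hk => (hres k hk).2⟩⟩
  have hN0 : 0 ≤ N := le_trans (by positivity) hN
  set M : ℝ := N ^ ((1 : ℝ) / (2 * n)) with hMdef
  have hMN : M ^ (2 * n) = N := by
    rw [hMdef, one_div, show (2 * n : ℝ) = ((2 * n : ℕ) : ℝ) by push_cast; rfl]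
    exact Real.rpow_inv_natCast_pow hN0 (by omega)
  have hM : (n : ℝ) ^ n ≤ M :=
    le_of_pow_le_pow_left₀ (by omega : 2 * n ≠ 0) (by positivity) (hN.trans_eq hMN.symm)
  rw [Set.union_sdiff_self]
  ext k
  simp only [Set.mem_sdiff, Set.mem_union, Set.mem_iUnion, mem_iInter_Rres (by omega : 2 ≤ n)]
  constructor
  · rintro ⟨hk, hJ⟩
    by_contra! hcon
    obtain ⟨hR, h3, hI⟩ := hcon
    obtain ⟨l₀, hl₀, hΩ⟩ := hR hk
    obtain ⟨l, hl, hl1, hl2⟩ := exists_normInf_pow_le hn hM hk h3 hI hl₀ hΩ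
    rw [hMN] at hl2
    exact hJ ⟨l, hl, ⟨hk, hl1, hl2⟩, fun h => h.elim h3 hI⟩
  · rintro (⟨hk, hR⟩ | hA)
    · exact ⟨hk, fun ⟨l, hl, hJ, _⟩ => hJ.2.1 (hR l hl)⟩
    · exact ⟨hA.elim And.left And.left, fun ⟨l, hl, _, hJ⟩ => hJ hA⟩
end

section
/- Let s ≥ 2 be real, let n ≥ 3, let M > 0, and let k = (k_1, …, k_n) be a tuple of nonzero integers with k_1 + ⋯ + k_n = 0, |k_1| ≥ |k_2| ≥ ⋯ ≥ |k_n|, and |k_3| ≥ M. Then |k_1 |k_1|^{2s} + k_2 |k_2|^{2s}| ≤ (2s+1) · n^{s+1} · M^{−s+2} · |k_1|^s |k_2|^s |k_3|^{s−1}. -/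
/-- The signed power `m|m|^{2s}`. -/
noncomputable def sPow (s : ℝ) (m : ℤ) : ℝ := (m : ℝ) * ((m.natAbs : ℝ)) ^ (2 * s)

/-- Mean value bound for the power `t ↦ t ^ (p + 1)`, by Bernoulli's inequality. -/
lemma mul_rpow_sub_mul_rpow_le {a b p : ℝ} (hb : 0 < b) (ha : 0 < a) (hp : 0 ≤ p) :
    a * a ^ p - b * b ^ p ≤ (p + 1) * a ^ p * (a - b) := by
  have h := one_add_mul_self_le_rpow_one_add (s := b / a - 1) (p := p + 1)
    (by linarith [div_pos hb ha]) (by linarith)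
  rw [add_sub_cancel, Real.div_rpow hb.le ha.le, le_div_iff₀ (Real.rpow_pos_of_pos ha _),
    Real.rpow_add_one hb.ne', Real.rpow_add_one ha.ne'] at h
  have e : (1 + (p + 1) * (b / a - 1)) * (a ^ p * a)
      = a ^ p * a + (p + 1) * a ^ p * (b - a) := by
    field_simp
  linarith

/-- The signed power is Lipschitz, in the form of a bound on the sum of two signed powers. -/
lemma abs_mul_abs_rpow_add_le {x y p : ℝ} (hx : x ≠ 0) (hy : y ≠ 0) (hp : 0 ≤ p)
    (hxy : |y| ≤ |x|) :
    |x * |x| ^ p + y * |y| ^ p| ≤ (p + 1) * |x| ^ p * |x + y| := by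
  wlog hx0 : 0 < x generalizing x y
  · have h := this (x := -x) (y := -y) (neg_ne_zero.2 hx) (neg_ne_zero.2 hy) (by simpa using hxy)
      (by have := lt_of_le_of_ne (not_lt.1 hx0) hx; linarith)
    simp only [abs_neg, neg_mul, ← neg_add] at h
    exact h
  have hpx := Real.rpow_pos_of_pos hx0 p
  rw [abs_of_pos hx0] at hxy ⊢
  rcases lt_or_gt_of_ne hy with hy0 | hy0
  · rw [abs_of_neg hy0] at hxy ⊢
    have h := mul_rpow_sub_mul_rpow_le (neg_pos.2 hy0) hx0 hp
    have h' : (-y) * (-y) ^ p ≤ x * x ^ p := by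
      have := Real.rpow_nonneg (neg_pos.2 hy0).le p
      gcongr
      linarith
    rw [abs_of_nonneg (by linarith), abs_of_nonneg (by linarith)]
    linarith
  · rw [abs_of_pos hy0] at hxy ⊢
    have h : y ^ p ≤ x ^ p := by gcongr
    rw [abs_of_nonneg (by positivity), abs_of_nonneg (by positivity)]
    nlinarith [mul_nonneg (mul_nonneg hp hpx.le) (add_pos hx0 hy0).le]

/-- In a zero-sum tuple ordered by decreasing absolute value, the sum of the first two entries
is controlled by the third. -/
lemma abs_add_le_of_sum_eq_zero {m : ℕ} (k : Fin (m + 3) → ℤ) (hsum : ∑ i, k i = 0)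
    (hsort : ∀ i j : Fin (m + 3), i ≤ j → |k j| ≤ |k i|) :
    |k 0 + k 1| ≤ ((m : ℤ) + 1) * |k 2| := by
  rw [Fin.sum_univ_succ, Fin.sum_univ_succ] at hsum
  have h : |∑ i : Fin (m + 1), k i.succ.succ| ≤ ∑ _i : Fin (m + 1), |k 2| :=
    (Finset.abs_sum_le_sum_abs _ _).trans (Finset.sum_le_sum fun i _ => hsort _ _ (by
      exact Fin.succ_le_succ_iff.2 (Fin.succ_le_succ_iff.2 (Fin.zero_le i))))
  have e : k 0 + k 1 = -∑ i : Fin (m + 1), k i.succ.succ := by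
    have : k 0 + (k 1 + ∑ i : Fin (m + 1), k i.succ.succ) = 0 := hsum
    linarith
  rw [e, abs_neg]
  simpa using h

/-- If `k ∈ D_n` (nonzero, zero momentum, ordered by decreasing
absolute value) and `|k₃| ≥ M`, then
`|k₁|k₁|^{2s} + k₂|k₂|^{2s}| ≤ (2s+1) n^{s+1} M^{−s+2} |k₁|^s |k₂|^s |k₃|^{s−1}`. -/
theorem stmt15 (s : ℝ) (hs : 2 ≤ s) (n : ℕ) (hn : 3 ≤ n) (M : ℝ) (hM : 0 < M)
    (k : Fin n → ℤ) (hk0 : ∀ i, k i ≠ 0) (hsum : ∑ i, k i = 0)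
    (hsort : ∀ i j : Fin n, i ≤ j → |k j| ≤ |k i|)
    (hk3 : M ≤ (((k ⟨2, by omega⟩).natAbs : ℝ))) :
    |sPow s (k ⟨0, by omega⟩) + sPow s (k ⟨1, by omega⟩)|
      ≤ (2 * s + 1) * (n : ℝ) ^ (s + 1) * M ^ (-s + 2) *
        ((((k ⟨0, by omega⟩).natAbs : ℝ)) ^ s * (((k ⟨1, by omega⟩).natAbs : ℝ)) ^ s *
          (((k ⟨2, by omega⟩).natAbs : ℝ)) ^ (s - 1)) := by
  have hadd : |k ⟨0, by omega⟩ + k ⟨1, by omega⟩| ≤ ((n : ℤ) - 2) * |k ⟨2, by omega⟩| := by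
    obtain ⟨m, rfl⟩ := Nat.exists_eq_add_of_le' hn
    have h := abs_add_le_of_sum_eq_zero k hsum hsort
    rw [show ((m : ℤ) + 1) = ((m + 3 : ℕ) : ℤ) - 2 by push_cast; ring] at h
    exact h
  have h01 := hsort ⟨0, by omega⟩ ⟨1, by omega⟩ (by simp [Fin.le_def])
  have h12 := hsort ⟨1, by omega⟩ ⟨2, by omega⟩ (by simp [Fin.le_def])
  have hx := hk0 ⟨0, by omega⟩
  have hy := hk0 ⟨1, by omega⟩
  simp only [sPow, Nat.cast_natAbs, Int.cast_abs] at hk3 ⊢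
  generalize k ⟨0, by omega⟩ = x at *
  generalize k ⟨1, by omega⟩ = y at *
  generalize k ⟨2, by omega⟩ = z at *
  replace hadd : |(x : ℝ) + y| ≤ ((n : ℝ) - 2) * |(z : ℝ)| := by exact_mod_cast hadd
  replace h01 : |(y : ℝ)| ≤ |(x : ℝ)| := by exact_mod_cast h01
  replace h12 : |(z : ℝ)| ≤ |(y : ℝ)| := by exact_mod_cast h12
  replace hx : (x : ℝ) ≠ 0 := by exact_mod_cast hx
  replace hy : (y : ℝ) ≠ 0 := by exact_mod_cast hy
  have hn' : (3 : ℝ) ≤ n := by exact_mod_cast hn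
  have hlip := abs_mul_abs_rpow_add_le hx hy (by linarith : 0 ≤ 2 * s) h01
  have hxn : |(x : ℝ)| ≤ n * |(y : ℝ)| := by
    have h := abs_sub ((x : ℝ) + y) y
    rw [add_sub_cancel_right] at h
    nlinarith [abs_nonneg (y : ℝ)]
  have hxpos := abs_pos.2 hx
  have hypos := abs_pos.2 hy
  have hzpos : 0 < |(z : ℝ)| := hM.trans_le hk3
  generalize |(x : ℝ)| = a at *
  generalize |(y : ℝ)| = b at *
  generalize |(z : ℝ)| = c at *
  have hpow : a ^ (2 * s) ≤ a ^ s * (n ^ s * b ^ s) := by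
    rw [two_mul, Real.rpow_add hxpos, ← Real.mul_rpow (by positivity) hypos.le]
    gcongr
  have hc : c ≤ M ^ (-s + 2) * c ^ (s - 1) := by
    have h : M ^ (s - 2) ≤ c ^ (s - 2) := Real.rpow_le_rpow hM.le hk3 (by linarith)
    rw [show -s + 2 = -(s - 2) by ring, show s - 1 = (s - 2) + 1 by ring,
      Real.rpow_neg hM.le, Real.rpow_add_one hzpos.ne', ← mul_assoc]
    refine le_mul_of_one_le_left hzpos.le ?_
    rw [inv_mul_eq_div]
    exact (one_le_div (Real.rpow_pos_of_pos hM _)).2 h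
  calc _ ≤ (2 * s + 1) * a ^ (2 * s) * |(x : ℝ) + y| := hlip
    _ ≤ (2 * s + 1) * (a ^ s * (n ^ s * b ^ s)) * (n * (M ^ (-s + 2) * c ^ (s - 1))) := by
      gcongr
      calc _ ≤ ((n : ℝ) - 2) * c := hadd
        _ ≤ n * c := by nlinarith
        _ ≤ _ := by gcongr
    _ = (2 * s + 1) * (n : ℝ) ^ (s + 1) * M ^ (-s + 2) * (a ^ s * b ^ s * c ^ (s - 1)) := by
      rw [Real.rpow_add_one (by positivity : (n : ℝ) ≠ 0)]
      ring
end
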